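/- arXiv:2506.19149 — 2 statements merged into one kernel-verified Lean document; each statement's English description precedes it below -/
import Mathlib

section
/- Every connected n-vertex graph G with no induced 6-cycles satisfies ι(G, P_3) ≤ ⌊(n+1)/4⌋. -/
open SimpleGraph

/-- The closed neighbourhood `N[D]` of a set `D` of vertices in a graph `G`. -/
def closedNbhd {V : Type*} (G : SimpleGraph V) (D : Set V) : Set V :=
  D ∪ {v | ∃ d ∈ D, G.Adj d v}

/-- `G` contains a (not necessarily induced) copy of `H`. -/
def ContainsCopy {α β : Type*} (G : SimpleGraph α) (H : SimpleGraph β) : Prop :=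
  ∃ f : β ↪ α, ∀ a b, H.Adj a b → G.Adj (f a) (f b)

/-- `D` is a `P₃`-isolating set of `G`: `G − N[D]` contains no 3-vertex path. -/
def IsP3IsolatingSet {V : Type*} (G : SimpleGraph V) (D : Set V) : Prop :=
  ¬ ContainsCopy (SimpleGraph.induce (closedNbhd G D)ᶜ G) (SimpleGraph.pathGraph 3)

/-- The `P₃`-isolation number of `G`. -/
noncomputable def iotaP3 {V : Type*} (G : SimpleGraph V) : ℕ :=
  sInf {m | ∃ D : Set V, IsP3IsolatingSet G D ∧ D.ncard = m}

/-- `G` has an induced 6-cycle. -/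
def HasInducedC6 {V : Type*} (G : SimpleGraph V) : Prop :=
  ∃ f : Fin 6 ↪ V, ∀ a b, G.Adj (f a) (f b) ↔ (SimpleGraph.cycleGraph 6).Adj a b

namespace P3Iso

variable {V : Type*} [DecidableEq V] (G : SimpleGraph V)

/-- `v` lies in the closed neighbourhood of `D`. -/
def dom (D : Finset V) (v : V) : Prop := v ∈ D ∨ ∃ d ∈ D, G.Adj d v

/-- no 3-path of `G[S]` avoids the closed neighbourhood of `D`. -/
def Iso (S D : Finset V) : Prop :=
  ∀ a ∈ S, ∀ b ∈ S, ∀ c ∈ S, a ≠ c → G.Adj a b → G.Adj b c →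
    dom G D a ∨ dom G D b ∨ dom G D c

/-- `G[S]` is connected. -/
def Conn (S : Finset V) : Prop :=
  S.Nonempty ∧ ∀ A ⊆ S, A.Nonempty → A ≠ S → ∃ a ∈ A, ∃ b ∈ S, b ∉ A ∧ G.Adj a b

/-- `P` is the set of components of `G[W]`. -/
structure Dec (W : Finset V) (P : Finset (Finset V)) : Prop where
  conn : ∀ C ∈ P, Conn G C
  sub : ∀ C ∈ P, C ⊆ W
  cov : ∀ v ∈ W, ∃ C ∈ P, v ∈ C
  sep : ∀ C ∈ P, ∀ C' ∈ P, C ≠ C' → ∀ a ∈ C, ∀ b ∈ C', a ≠ b ∧ ¬ G.Adj a b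
  card : ∑ C ∈ P, C.card = W.card

/-- bound for connected sets -/
def M (S : Finset V) : Prop := ∃ D, Iso G S D ∧ 4 * D.card ≤ S.card + 1
/-- rooted bound -/
def R (S : Finset V) : Prop := ∀ y ∈ S, ∃ D, Iso G (S.erase y) D ∧ 4 * D.card ≤ S.card
/-- the extremal sets -/
def Bad (S : Finset V) : Prop := ¬ ∃ D, Iso G S D ∧ 4 * D.card ≤ S.card
/-- some edge joins `D` to `C` -/
def Touch (D C : Finset V) : Prop := ∃ d ∈ D, ∃ c ∈ C, G.Adj d c

variable {G}

lemma dom_mono {D D' : Finset V} (h : D ⊆ D') {v : V} (hv : dom G D v) : dom G D' v := by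
  rcases hv with hv | ⟨d, hd, hv⟩
  · exact Or.inl (h hv)
  · exact Or.inr ⟨d, h hd, hv⟩

lemma exists_dec (W : Finset V) : ∃ P, Dec G W P := by
  induction W using Finset.strongInduction with
  | H W ih =>
    by_cases h0 : W.Nonempty
    · by_cases hc : Conn G W
      · refine ⟨{W}, ?_, ?_, ?_, ?_, ?_⟩
        · simpa using hc
        · simp
        · simp
        · intro C hC C' hC' h
          simp at hC hC'
          exact absurd (hC.trans hC'.symm) h
        · simp
      · have : ∃ A ⊆ W, A.Nonempty ∧ A ≠ W ∧ ∀ a ∈ A, ∀ b ∈ W, b ∉ A → ¬ G.Adj a b := by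
          by_contra hcon
          push Not at hcon
          exact hc ⟨h0, hcon⟩
        obtain ⟨A, hA, hA0, hA1, hsep⟩ := this
        obtain ⟨P, hP⟩ := ih A (Finset.ssubset_iff_subset_ne.2 ⟨hA, hA1⟩)
        obtain ⟨Q, hQ⟩ := ih (W \ A) (Finset.sdiff_ssubset hA hA0)
        have key : ∀ C ∈ P, ∀ C' ∈ Q, ∀ a ∈ C, ∀ b ∈ C', a ≠ b ∧ ¬ G.Adj a b := by
          intro C hC C' hC' a ha b hb
          have h1 := hP.sub C hC ha
          have h2 := Finset.mem_sdiff.1 (hQ.sub C' hC' hb)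
          exact ⟨fun h => h2.2 (h ▸ h1), hsep a h1 b h2.1 h2.2⟩
        refine ⟨P ∪ Q, ?_, ?_, ?_, ?_, ?_⟩
        · intro C hC
          rcases Finset.mem_union.1 hC with h | h
          · exact hP.conn C h
          · exact hQ.conn C h
        · intro C hC
          rcases Finset.mem_union.1 hC with h | h
          · exact (hP.sub C h).trans hA
          · exact (hQ.sub C h).trans Finset.sdiff_subset
        · intro v hv
          by_cases hvA : v ∈ A
          · obtain ⟨C, hC, h⟩ := hP.cov v hvA
            exact ⟨C, Finset.mem_union_left _ hC, h⟩
          · obtain ⟨C, hC, h⟩ := hQ.cov v (Finset.mem_sdiff.2 ⟨hv, hvA⟩)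
            exact ⟨C, Finset.mem_union_right _ hC, h⟩
        · intro C hC C' hC' hne a ha b hb
          rcases Finset.mem_union.1 hC with h | h <;> rcases Finset.mem_union.1 hC' with h' | h'
          · exact hP.sep C h C' h' hne a ha b hb
          · exact key C h C' h' a ha b hb
          · have := key C' h' C h b hb a ha
            exact ⟨this.1.symm, fun h => this.2 h.symm⟩
          · exact hQ.sep C h C' h' hne a ha b hb
        · rw [Finset.sum_union, hP.card, hQ.card, add_comm, Finset.card_sdiff_add_card_eq_card hA]
          rw [Finset.disjoint_left]
          intro C h h'
          obtain ⟨a, ha⟩ := (hP.conn C h).1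
          exact (key C h C h' a ha a ha).1 rfl
    · rw [Finset.not_nonempty_iff_eq_empty] at h0
      subst h0
      exact ⟨∅, by simp, by simp, by simp, by simp, by simp⟩

/-- a connected set without edges to the rest of `W` is one of the components -/
lemma Dec.mem {W : Finset V} {P : Finset (Finset V)} (h : Dec G W P) {C : Finset V}
    (hC : Conn G C) (hCW : C ⊆ W) (hcl : ∀ a ∈ C, ∀ b ∈ W, G.Adj a b → b ∈ C) : C ∈ P := by
  obtain ⟨c, hc⟩ := hC.1
  obtain ⟨C', hC', hcC'⟩ := h.cov c (hCW hc)
  have hne : (C ∩ C').Nonempty := ⟨c, Finset.mem_inter.2 ⟨hc, hcC'⟩⟩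
  have h1 : C ∩ C' = C := by
    by_contra hcon
    obtain ⟨a, ha, b, hb, hba, hadj⟩ := hC.2 _ Finset.inter_subset_left hne hcon
    obtain ⟨C'', hC'', hbC''⟩ := h.cov b (hCW hb)
    have hd : C' ≠ C'' := by
      rintro rfl
      exact hba (Finset.mem_inter.2 ⟨hb, hbC''⟩)
    exact (h.sep C' hC' C'' hC'' hd a (Finset.mem_inter.1 ha).2 b hbC'').2 hadj
  have h2 : C ∩ C' = C' := by
    by_contra hcon
    obtain ⟨a, ha, b, hb, hba, hadj⟩ :=
      (h.conn C' hC').2 _ Finset.inter_subset_right hne hcon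
    have ha' := (Finset.mem_inter.1 ha).1
    exact hba (Finset.mem_inter.2 ⟨hcl a ha' b (h.sub C' hC' hb) hadj, hb⟩)
  rw [← h1, h2]
  exact hC'

open Classical in
lemma key {W : Finset V} {P : Finset (Finset V)} (h : Dec G W P)
    (hM : ∀ C ∈ P, M G C) (hR : ∀ C ∈ P, R G C) (D : Finset V) :
    ∃ D', D ⊆ D' ∧ Iso G W D' ∧
      4 * D'.card + 3 * (P.filter (fun C => Bad G C ∧ Touch G D C)).card ≤
        4 * D.card + W.card + (P.filter (fun C => Bad G C ∧ ¬ Touch G D C)).card := by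
  have hex : ∀ C : Finset V, ∃ E : Finset V, C ∈ P → (∀ F, D ⊆ F → E ⊆ F → Iso G C F) ∧
      4 * E.card + 3 * (if Bad G C ∧ Touch G D C then 1 else 0) ≤
        C.card + (if Bad G C ∧ ¬ Touch G D C then 1 else 0) := by
    intro C
    by_cases hC : C ∈ P
    swap
    · exact ⟨∅, fun h => absurd h hC⟩
    obtain ⟨E, hE, hEc⟩ := hM C hC
    have mono : ∀ {A E F : Finset V}, Iso G A E → E ⊆ F → Iso G A F := by
      intro A E F hI hEF a ha b hb c hc h1 h2 h3
      rcases hI a ha b hb c hc h1 h2 h3 with h | h | h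
      · exact Or.inl (dom_mono hEF h)
      · exact Or.inr (Or.inl (dom_mono hEF h))
      · exact Or.inr (Or.inr (dom_mono hEF h))
    by_cases hb : Bad G C
    · by_cases ht : Touch G D C
      · have hlt : ¬ 4 * E.card ≤ C.card := fun hle => hb ⟨E, hE, hle⟩
        obtain ⟨d, hd, c, hc, hdc⟩ := ht
        obtain ⟨E', hE', hEc'⟩ := hR C hC c hc
        refine ⟨E', fun _ => ⟨?_, ?_⟩⟩
        · intro F hDF hEF a ha b hb x hx h1 h2 h3
          have hcF : dom G F c := Or.inr ⟨d, hDF hd, hdc⟩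
          by_cases e1 : a = c
          · subst e1; exact Or.inl hcF
          by_cases e2 : b = c
          · subst e2; exact Or.inr (Or.inl hcF)
          by_cases e3 : x = c
          · subst e3; exact Or.inr (Or.inr hcF)
          exact mono hE' hEF a (Finset.mem_erase.2 ⟨e1, ha⟩) b (Finset.mem_erase.2 ⟨e2, hb⟩)
            x (Finset.mem_erase.2 ⟨e3, hx⟩) h1 h2 h3
        · have : Touch G D C := ⟨d, hd, c, hc, hdc⟩
          simp only [hb, this, and_true, if_true, not_true, and_false, if_false]
          omega
      · refine ⟨E, fun _ => ⟨fun F _ hEF => mono hE hEF, ?_⟩⟩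
        simp only [hb, ht, and_false, if_false, not_false_iff, and_self, if_true]
        omega
    · have hb' := hb
      unfold Bad at hb'
      push Not at hb'
      obtain ⟨E', hE', hEc'⟩ := hb'
      refine ⟨E', fun _ => ⟨fun F _ hEF => mono hE' hEF, ?_⟩⟩
      simp only [hb, false_and, if_false]
      omega
  choose E hE using hex
  refine ⟨D ∪ P.biUnion E, Finset.subset_union_left, ?_, ?_⟩
  · intro a ha b hb c hc hac hab hbc
    obtain ⟨C, hC, hbC⟩ := h.cov b hb
    have mem : ∀ x ∈ W, G.Adj b x → x ∈ C := by
      intro x hx hbx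
      obtain ⟨C', hC', hxC'⟩ := h.cov x hx
      by_cases hne : C = C'
      · subst hne; exact hxC'
      · exact absurd hbx (h.sep C hC C' hC' hne b hbC x hxC').2
    exact (hE C hC).1 _ Finset.subset_union_left
      ((Finset.subset_biUnion_of_mem E hC).trans Finset.subset_union_right)
      a (mem a ha hab.symm) b hbC c (mem c hc hbc) hac hab hbc
  · have h1 : (D ∪ P.biUnion E).card ≤ D.card + ∑ C ∈ P, (E C).card :=
      (Finset.card_union_le _ _).trans (Nat.add_le_add_left Finset.card_biUnion_le _)
    have h2 := Finset.sum_le_sum (fun C hC => (hE C hC).2)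
    rw [Finset.sum_add_distrib, Finset.sum_add_distrib, ← Finset.mul_sum, ← Finset.mul_sum,
      h.card, ← Finset.card_filter, ← Finset.card_filter] at h2
    omega

/-- components of `S \ T` touch `T` -/
lemma touch_of_conn {S T : Finset V} (hS : Conn G S) (hT : T.Nonempty) (hTS : T ⊆ S)
    {P : Finset (Finset V)} (h : Dec G (S \ T) P) {C : Finset V} (hC : C ∈ P) :
    Touch G T C := by
  have hsub := h.sub C hC
  obtain ⟨t, ht⟩ := hT
  have hne : C ≠ S := by
    rintro rfl
    exact (Finset.mem_sdiff.1 (hsub (hTS ht))).2 ht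
  obtain ⟨a, ha, b, hb, hba, hadj⟩ :=
    hS.2 C (hsub.trans Finset.sdiff_subset) (h.conn C hC).1 hne
  by_cases hbT : b ∈ T
  · exact ⟨b, hbT, a, ha, hadj.symm⟩
  · obtain ⟨C', hC', hbC'⟩ := h.cov b (Finset.mem_sdiff.2 ⟨hb, hbT⟩)
    have hd : C ≠ C' := by
      rintro rfl
      exact hba hbC'
    exact absurd hadj (h.sep C hC C' hC' hd a ha b hbC').2

lemma iso_of_sdiff {S T D : Finset V} (h : Iso G (S \ T) D) (hT : ∀ t ∈ T, dom G D t) :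
    Iso G S D := by
  intro a ha b hb c hc h1 h2 h3
  by_cases e1 : a ∈ T
  · exact Or.inl (hT a e1)
  by_cases e2 : b ∈ T
  · exact Or.inr (Or.inl (hT b e2))
  by_cases e3 : c ∈ T
  · exact Or.inr (Or.inr (hT c e3))
  exact h a (Finset.mem_sdiff.2 ⟨ha, e1⟩) b (Finset.mem_sdiff.2 ⟨hb, e2⟩)
    c (Finset.mem_sdiff.2 ⟨hc, e3⟩) h1 h2 h3

lemma rooted {S : Finset V} (hS : Conn G S)
    (ih : ∀ C, Conn G C → C.card < S.card → M G C ∧ R G C) : R G S := by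
  classical
  intro y hy
  obtain ⟨P, hP⟩ := exists_dec (G := G) (S \ {y})
  have hlt : ∀ C ∈ P, C.card < S.card := by
    intro C hC
    refine Finset.card_lt_card (Finset.ssubset_of_subset_of_ssubset (hP.sub C hC) ?_)
    exact Finset.sdiff_ssubset (by simpa using hy) (by simp)
  have hM : ∀ C ∈ P, M G C := fun C hC => (ih C (hP.conn C hC) (hlt C hC)).1
  have hR : ∀ C ∈ P, R G C := fun C hC => (ih C (hP.conn C hC) (hlt C hC)).2
  have hcard : (S \ {y}).card + 1 = S.card := by
    have := Finset.card_sdiff_add_card_eq_card (show ({y} : Finset V) ⊆ S by simpa using hy)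
    simpa using this
  rw [Finset.erase_eq]
  by_cases hb : ∃ C ∈ P, Bad G C
  · obtain ⟨C, hC, hbC⟩ := hb
    obtain ⟨D', -, hI, hc⟩ := key hP hM hR {y}
    refine ⟨D', hI, ?_⟩
    have ht : ∀ C ∈ P, Touch G {y} C := fun C hC =>
      touch_of_conn hS (by simp) (by simpa using hy) hP hC
    have h0 : P.filter (fun C => Bad G C ∧ ¬ Touch G {y} C) = ∅ := by
      rw [Finset.filter_eq_empty_iff]
      intro C hC h
      exact h.2 (ht C hC)
    have h1 : 0 < (P.filter (fun C => Bad G C ∧ Touch G {y} C)).card :=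
      Finset.card_pos.2 ⟨C, Finset.mem_filter.2 ⟨hC, hbC, ht C hC⟩⟩
    rw [h0] at hc
    simp only [Finset.card_empty, Finset.card_singleton] at hc
    omega
  · push Not at hb
    obtain ⟨D', -, hI, hc⟩ := key hP hM hR ∅
    refine ⟨D', hI, ?_⟩
    have h0 : P.filter (fun C => Bad G C ∧ ¬ Touch G ∅ C) = ∅ := by
      rw [Finset.filter_eq_empty_iff]
      intro C hC h
      exact hb C hC h.1
    rw [h0] at hc
    simp only [Finset.card_empty] at hc
    omega

open Classical in
/-- main inequality in a counterexample -/
lemma star_ineq {S : Finset V}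
    (ih : ∀ C, Conn G C → C.card < S.card → M G C ∧ R G C) (hn : ¬ M G S)
    {T D : Finset V} (hT : T.Nonempty) (hTS : T ⊆ S) (hD : ∀ t ∈ T, dom G D t)
    {P : Finset (Finset V)} (hP : Dec G (S \ T) P) :
    T.card + 3 * (P.filter (fun C => Bad G C ∧ Touch G D C)).card + 2 ≤
      4 * D.card + (P.filter (fun C => Bad G C ∧ ¬ Touch G D C)).card := by
  have hlt : ∀ C ∈ P, C.card < S.card := by
    intro C hC
    refine Finset.card_lt_card (Finset.ssubset_of_subset_of_ssubset (hP.sub C hC) ?_)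
    exact Finset.sdiff_ssubset hTS hT
  have hM : ∀ C ∈ P, M G C := fun C hC => (ih C (hP.conn C hC) (hlt C hC)).1
  have hR : ∀ C ∈ P, R G C := fun C hC => (ih C (hP.conn C hC) (hlt C hC)).2
  obtain ⟨D', hDD, hI, hc⟩ := key hP hM hR D
  have hlt : ¬ 4 * D'.card ≤ S.card + 1 := fun hle =>
    hn ⟨D', iso_of_sdiff hI (fun t ht => dom_mono hDD (hD t ht)), hle⟩
  have := Finset.card_sdiff_add_card_eq_card hTS
  omega

lemma cut {S : Finset V} (hS : Conn G S)
    (ih : ∀ C, Conn G C → C.card < S.card → M G C ∧ R G C) (hn : ¬ M G S)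
    {C : Finset V} (hC : Conn G C) (hCS : C ⊆ S) (hb : Bad G C) {t : V} (ht : t ∈ S)
    (htC : t ∉ C) (hcl : ∀ a ∈ C, ∀ b ∈ S, G.Adj a b → b ∈ C ∨ b = t) : False := by
  classical
  obtain ⟨P, hP⟩ := exists_dec (G := G) (S \ {t})
  have hmem : C ∈ P := by
    apply hP.mem hC
    · intro c hc
      refine Finset.mem_sdiff.2 ⟨hCS hc, ?_⟩
      rw [Finset.mem_singleton]
      rintro rfl
      exact htC hc
    · intro a ha b hb hab
      have hb' := Finset.mem_sdiff.1 hb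
      rcases hcl a ha b hb'.1 hab with h | h
      · exact h
      · exact absurd (Finset.mem_singleton.2 h) hb'.2
  have htt : ∀ C ∈ P, Touch G {t} C := fun C hC =>
    touch_of_conn hS (by simp) (by simpa using ht) hP hC
  have hin := star_ineq ih hn (T := {t}) (D := {t}) (by simp) (by simpa using ht)
    (fun s hs => Or.inl hs) hP
  have h0 : P.filter (fun C => Bad G C ∧ ¬ Touch G {t} C) = ∅ := by
    rw [Finset.filter_eq_empty_iff]
    intro C hC h
    exact h.2 (htt C hC)
  have h1 : 0 < (P.filter (fun C => Bad G C ∧ Touch G {t} C)).card :=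
    Finset.card_pos.2 ⟨C, Finset.mem_filter.2 ⟨hmem, hb, htt C hmem⟩⟩
  rw [h0] at hin
  simp only [Finset.card_empty, Finset.card_singleton] at hin
  omega

set_option maxHeartbeats 2000000 in
/-- a counterexample has maximum degree at most two -/
lemma no_claw {S : Finset V} (hS : Conn G S)
    (ih : ∀ C, Conn G C → C.card < S.card → M G C ∧ R G C) (hn : ¬ M G S)
    {x v y z : V} (hx : x ∈ S) (hv : v ∈ S) (hy : y ∈ S) (hz : z ∈ S)
    (hxv : G.Adj x v) (hxy : G.Adj x y) (hxz : G.Adj x z)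
    (hvy : v ≠ y) (hvz : v ≠ z) (hyz : y ≠ z) : False := by
  classical
  set T : Finset V := {x, v, y, z} with hTdef
  have hT : T.Nonempty := ⟨x, by simp [hTdef]⟩
  have hTS : T ⊆ S := by
    intro a ha
    simp only [hTdef, Finset.mem_insert, Finset.mem_singleton] at ha
    rcases ha with rfl | rfl | rfl | rfl <;> assumption
  have hTc : T.card = 4 := by
    rw [hTdef, Finset.card_insert_of_notMem, Finset.card_insert_of_notMem,
      Finset.card_insert_of_notMem, Finset.card_singleton]
    · simpa using hyz
    · simp [hvy, hvz]
    · simp [hxv.ne, hxy.ne, hxz.ne]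
  obtain ⟨P, hP⟩ := exists_dec (G := G) (S \ T)
  -- every bad component is attached to two vertices of `T`
  have two : ∀ C ∈ P, Bad G C → ∀ t ∈ T, ∃ s ∈ T, s ≠ t ∧ Touch G {s} C := by
    intro C hC hb t ht
    by_contra hcon
    push Not at hcon
    refine cut hS ih hn (hP.conn C hC) ((hP.sub C hC).trans Finset.sdiff_subset) hb (hTS ht)
      (fun h => (Finset.mem_sdiff.1 (hP.sub C hC h)).2 ht) ?_
    intro a ha b hb hab
    by_cases hbT : b ∈ T
    · right
      by_contra hbt
      exact hcon b hbT hbt ⟨b, by simp, a, ha, hab.symm⟩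
    · left
      obtain ⟨C', hC', hbC'⟩ := hP.cov b (Finset.mem_sdiff.2 ⟨hb, hbT⟩)
      by_cases hd : C = C'
      · subst hd; exact hbC'
      · exact absurd hab (hP.sep C hC C' hC' hd a ha b hbC').2
  have tmono : ∀ {A B C : Finset V}, A ⊆ B → Touch G A C → Touch G B C := by
    rintro A B C h ⟨d, hd, r⟩
    exact ⟨d, h hd, r⟩
  have hsplit : ∀ D : Finset V, (P.filter (fun C => Bad G C ∧ Touch G D C)).card +
      (P.filter (fun C => Bad G C ∧ ¬ Touch G D C)).card = (P.filter (fun C => Bad G C)).card := by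
    intro D
    rw [← Finset.filter_filter, ← Finset.filter_filter]
    exact Finset.card_filter_add_card_filter_not _
  -- D = {x}
  have i1 := star_ineq ih hn (T := T) (D := {x}) hT hTS (by
    intro t ht
    simp only [hTdef, Finset.mem_insert, Finset.mem_singleton] at ht
    rcases ht with rfl | rfl | rfl | rfl
    · exact Or.inl (by simp)
    all_goals exact Or.inr ⟨x, by simp, by assumption⟩) hP
  have s1 := hsplit {x}
  -- D = {v, y, z}
  have i2 := star_ineq ih hn (T := T) (D := {v, y, z}) hT hTS (by
    intro t ht
    simp only [hTdef, Finset.mem_insert, Finset.mem_singleton] at ht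
    rcases ht with rfl | rfl | rfl | rfl
    · exact Or.inr ⟨v, by simp, hxv.symm⟩
    all_goals exact Or.inl (by simp)) hP
  have s2 := hsplit {v, y, z}
  have z2 : P.filter (fun C => Bad G C ∧ ¬ Touch G {v, y, z} C) = ∅ := by
    rw [Finset.filter_eq_empty_iff]
    rintro C hC ⟨hb, ht⟩
    obtain ⟨s, hs, hsx, hst⟩ := two C hC hb x (by simp [hTdef])
    refine ht (tmono ?_ hst)
    simp only [hTdef, Finset.mem_insert, Finset.mem_singleton] at hs
    intro r hr
    rw [Finset.mem_singleton] at hr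
    subst hr
    simp only [Finset.mem_insert, Finset.mem_singleton]
    tauto
  have c2 : ({v, y, z} : Finset V).card ≤ 3 := Finset.card_le_three
  rw [z2] at i2 s2
  simp only [Finset.card_empty, Finset.card_singleton, hTc] at i1 i2 s2
  have hq : (P.filter (fun C => Bad G C)).card = 2 := by omega
  have hp : (P.filter (fun C => Bad G C ∧ Touch G {x} C)).card = 0 := by omega
  have nox : ∀ C ∈ P, Bad G C → ¬ Touch G {x} C := by
    intro C hC hb ht
    rw [Finset.card_eq_zero, Finset.filter_eq_empty_iff] at hp
    exact hp hC ⟨hb, ht⟩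
  -- D = {x, w}
  have i3 : ∀ w, ¬ (∀ C ∈ P, Bad G C → Touch G {w} C) := by
    intro w hw
    have i := star_ineq ih hn (T := T) (D := {x, w}) hT hTS (by
      intro t ht
      simp only [hTdef, Finset.mem_insert, Finset.mem_singleton] at ht
      rcases ht with rfl | rfl | rfl | rfl
      · exact Or.inl (by simp)
      all_goals exact Or.inr ⟨x, by simp, by assumption⟩) hP
    have s := hsplit {x, w}
    have zz : P.filter (fun C => Bad G C ∧ ¬ Touch G {x, w} C) = ∅ := by
      rw [Finset.filter_eq_empty_iff]
      rintro C hC ⟨hb, ht⟩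
      exact ht (tmono (by simp) (hw C hC hb))
    have c : ({x, w} : Finset V).card ≤ 2 := Finset.card_le_two
    rw [zz] at i s
    simp only [Finset.card_empty, hTc] at i s
    omega
  obtain ⟨C₁, C₂, hne, hCC⟩ := Finset.card_eq_two.1 hq
  have m1 : C₁ ∈ P ∧ Bad G C₁ := by
    have : C₁ ∈ P.filter (fun C => Bad G C) := by rw [hCC]; simp
    exact Finset.mem_filter.1 this
  have m2 : C₂ ∈ P ∧ Bad G C₂ := by
    have : C₂ ∈ P.filter (fun C => Bad G C) := by rw [hCC]; simp
    exact Finset.mem_filter.1 this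
  have i4 : ∀ w, ¬ (Touch G {w} C₁ ∧ Touch G {w} C₂) := by
    rintro w ⟨h1, h2⟩
    apply i3 w
    intro C hC hb
    have : C ∈ P.filter (fun C => Bad G C) := Finset.mem_filter.2 ⟨hC, hb⟩
    rw [hCC, Finset.mem_insert, Finset.mem_singleton] at this
    rcases this with rfl | rfl <;> assumption
  have three : ∀ C, C ∈ P ∧ Bad G C →
      (Touch G {v} C ∨ Touch G {y} C) ∧ (Touch G {v} C ∨ Touch G {z} C) ∧
      (Touch G {y} C ∨ Touch G {z} C) := by
    rintro C ⟨hC, hb⟩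
    have hx' := nox C hC hb
    refine ⟨?_, ?_, ?_⟩
    · obtain ⟨s, hs, hst, hh⟩ := two C hC hb z (by simp [hTdef])
      simp only [hTdef, Finset.mem_insert, Finset.mem_singleton] at hs
      rcases hs with rfl | rfl | rfl | rfl <;> tauto
    · obtain ⟨s, hs, hst, hh⟩ := two C hC hb y (by simp [hTdef])
      simp only [hTdef, Finset.mem_insert, Finset.mem_singleton] at hs
      rcases hs with rfl | rfl | rfl | rfl <;> tauto
    · obtain ⟨s, hs, hst, hh⟩ := two C hC hb v (by simp [hTdef])
      simp only [hTdef, Finset.mem_insert, Finset.mem_singleton] at hs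
      rcases hs with rfl | rfl | rfl | rfl <;> tauto
  have t1 := three C₁ m1
  have t2 := three C₂ m2
  have iv := i4 v
  have iy := i4 y
  have iz := i4 z
  clear i4 i3 i1 i2 s1 s2 three two nox tmono hsplit
  tauto

/-- `p` parametrises a path with `k` vertices inside `S` -/
def IsPath (G : SimpleGraph V) (S : Finset V) (k : ℕ) (p : ℕ → V) : Prop :=
  (∀ i < k, p i ∈ S) ∧ (∀ i < k, ∀ j < k, p i = p j → i = j) ∧
    ∀ i, i + 1 < k → G.Adj (p i) (p (i + 1))

lemma ham {S : Finset V} (hS : Conn G S)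
    (hdeg : ∀ x ∈ S, ∀ a ∈ S, ∀ b ∈ S, ∀ c ∈ S, G.Adj x a → G.Adj x b → G.Adj x c →
      a = b ∨ a = c ∨ b = c) :
    ∃ p, IsPath G S S.card p ∧ ∀ v ∈ S, ∃ i < S.card, p i = v := by
  classical
  have hbd : ∀ k p, IsPath G S k p → k ≤ S.card := by
    intro k p hp
    have := Finset.card_le_card_of_injOn (s := Finset.range k) (t := S) p
      (fun i hi => hp.1 i (by simpa using hi))
      (fun i hi j hj h => hp.2.1 i (by simpa using hi) j (by simpa using hj) h)
    simpa using this
  obtain ⟨s, hs⟩ := hS.1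
  have h1 : ∃ p, IsPath G S 1 p := ⟨fun _ => s, fun _ _ => hs, fun i hi j hj _ => by omega,
    fun i hi => by omega⟩
  have hpos : 1 ≤ S.card := Finset.card_pos.2 hS.1
  set k := Nat.findGreatest (fun k => ∃ p, IsPath G S k p) S.card with hk
  obtain ⟨p, hp⟩ : ∃ p, IsPath G S k p :=
    Nat.findGreatest_spec (P := fun k => ∃ p, IsPath G S k p) hpos h1
  have hk1 : 1 ≤ k := Nat.le_findGreatest hpos h1
  have hmax : ¬ ∃ p, IsPath G S (k + 1) p := by
    rintro ⟨q, hq⟩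
    have : k + 1 ≤ k := Nat.le_findGreatest (hbd _ _ hq) ⟨q, hq⟩
    omega
  have himg : (Finset.range k).image p = S := by
    by_contra hne
    obtain ⟨a, ha, b, hb, hba, hab⟩ := hS.2 ((Finset.range k).image p)
      (by intro a ha
          obtain ⟨i, hi, rfl⟩ := Finset.mem_image.1 ha
          exact hp.1 i (by simpa using hi))
      ⟨p 0, Finset.mem_image.2 ⟨0, Finset.mem_range.2 (by omega), rfl⟩⟩ hne
    obtain ⟨i, hi, rfl⟩ := Finset.mem_image.1 ha
    have hi : i < k := by simpa using hi
    have hnb : ∀ j < k, p j ≠ b := by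
      intro j hj h
      exact hba (Finset.mem_image.2 ⟨j, by simpa using hj, h⟩)
    by_cases hi0 : i = 0
    · subst hi0
      apply hmax
      refine ⟨fun j => if j = 0 then b else p (j - 1), ?_, ?_, ?_⟩
      · intro j hj
        by_cases hj0 : j = 0
        · simpa [hj0] using hb
        · simpa [hj0] using hp.1 (j - 1) (by omega)
      · intro j hj l hl h
        by_cases hj0 : j = 0 <;> by_cases hl0 : l = 0
        · omega
        · simp only [hj0, hl0, if_true, if_false] at h
          exact absurd h.symm (hnb _ (by omega))
        · simp only [hj0, hl0, if_true, if_false] at h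
          exact absurd h (hnb _ (by omega))
        · simp only [hj0, hl0, if_false] at h
          have := hp.2.1 _ (by omega) _ (by omega) h
          omega
      · intro j hj
        by_cases hj0 : j = 0
        · subst hj0
          simpa using hab.symm
        · have := hp.2.2 (j - 1) (by omega)
          rw [Nat.sub_add_cancel (by omega)] at this
          simpa [hj0] using this
    by_cases hik : i + 1 = k
    · apply hmax
      refine ⟨fun j => if j = k then b else p j, ?_, ?_, ?_⟩
      · intro j hj
        by_cases hj0 : j = k
        · simpa [hj0] using hb
        · simpa [hj0] using hp.1 j (by omega)
      · intro j hj l hl h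
        by_cases hj0 : j = k <;> by_cases hl0 : l = k
        · omega
        · simp only [hj0, hl0, if_true, if_false] at h
          exact absurd h.symm (hnb _ (by omega))
        · simp only [hj0, hl0, if_true, if_false] at h
          exact absurd h (hnb _ (by omega))
        · simp only [hj0, hl0, if_false] at h
          exact hp.2.1 _ (by omega) _ (by omega) h
      · intro j hj
        have hj0 : j ≠ k := by omega
        by_cases hjk : j + 1 = k
        · have : j = i := by omega
          subst this
          simpa [hjk, hj0] using hab
        · simpa [hjk, hj0] using hp.2.2 j (by omega)
    · have e1 := hp.2.2 i (by omega)
      have e2 := hp.2.2 (i - 1) (by omega)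
      rw [Nat.sub_add_cancel (by omega)] at e2
      rcases hdeg (p i) (hp.1 i hi) (p (i - 1)) (hp.1 _ (by omega)) (p (i + 1))
        (hp.1 _ (by omega)) b hb e2.symm e1 hab with h | h | h
      · have := hp.2.1 _ (by omega) _ (by omega) h
        omega
      · exact hnb _ (by omega) h
      · exact hnb _ (by omega) h
  have hkc : k = S.card := by
    rw [← himg, Finset.card_image_of_injOn, Finset.card_range]
    intro i hi j hj h
    exact hp.2.1 i (by simpa using hi) j (by simpa using hj) h
  rw [← hkc]
  refine ⟨p, hp, fun v hv => ?_⟩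
  rw [← himg] at hv
  obtain ⟨i, hi, h⟩ := Finset.mem_image.1 hv
  exact ⟨i, by simpa using hi, h⟩

lemma path_case (h6 : ¬ HasInducedC6 G) {S : Finset V} (hS : Conn G S)
    (hdeg : ∀ x ∈ S, ∀ a ∈ S, ∀ b ∈ S, ∀ c ∈ S, G.Adj x a → G.Adj x b → G.Adj x c →
      a = b ∨ a = c ∨ b = c) : M G S := by
  classical
  obtain ⟨p, ⟨hpS, hinj, hadj⟩, hsur⟩ := ham hS hdeg
  set n := S.card with hn
  have inner : ∀ i j, 0 < i → i + 1 < n → j < n → G.Adj (p i) (p j) → j + 1 = i ∨ j = i + 1 := by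
    intro i j hi0 hi hj h
    have e1 := hadj i (by omega)
    have e2 := hadj (i - 1) (by omega)
    rw [Nat.sub_add_cancel (by omega)] at e2
    rcases hdeg (p i) (hpS i (by omega)) (p (i - 1)) (hpS _ (by omega)) (p (i + 1))
        (hpS _ (by omega)) (p j) (hpS _ hj) e2.symm e1 h with h | h | h
    · have := hinj _ (by omega) _ (by omega) h
      omega
    · have := hinj _ (by omega) _ (by omega) h
      omega
    · have := hinj _ (by omega) _ (by omega) h
      omega
  have nbr : ∀ i j, i < n → j < n → G.Adj (p i) (p j) →
      j + 1 = i ∨ j = i + 1 ∨ (i = 0 ∧ j + 1 = n) ∨ (j = 0 ∧ i + 1 = n) := by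
    intro i j hi hj h
    by_cases hi1 : 0 < i ∧ i + 1 < n
    · have := inner i j hi1.1 hi1.2 hj h
      omega
    by_cases hj1 : 0 < j ∧ j + 1 < n
    · have := inner j i hj1.1 hj1.2 hi h.symm
      omega
    have hij : i ≠ j := by
      rintro rfl
      exact h.ne rfl
    omega
  -- it is enough to work with indices
  have red : ∀ D : Finset V, (∀ i < n, ∀ j < n, ∀ k < n, i ≠ k → G.Adj (p i) (p j) →
      G.Adj (p j) (p k) → dom G D (p i) ∨ dom G D (p j) ∨ dom G D (p k)) → Iso G S D := by
    intro D h a ha b hb c hc hac hab hbc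
    obtain ⟨i, hi, rfl⟩ := hsur a ha
    obtain ⟨j, hj, rfl⟩ := hsur b hb
    obtain ⟨k, hk, rfl⟩ := hsur c hc
    exact h i hi j hj k hk (fun h => hac (by rw [h])) hab hbc
  by_cases hn2 : n ≤ 2
  · refine ⟨∅, red ∅ ?_, by simp⟩
    intro i hi j hj k hk hik hij hjk
    have h1 : i ≠ j := by rintro rfl; exact hij.ne rfl
    have h2 : j ≠ k := by rintro rfl; exact hjk.ne rfl
    omega
  by_cases hn6 : n = 6
  · have hnc : ¬ G.Adj (p 0) (p 5) := by
      intro h05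
      apply h6
      refine ⟨⟨fun i => p i, fun i j h => Fin.ext (hinj _ (by omega) _ (by omega) h)⟩, ?_⟩
      intro a b
      have hcyc : (SimpleGraph.cycleGraph 6).Adj a b ↔
          ((b : ℕ) + 1 = a ∨ (b : ℕ) = a + 1 ∨ ((a : ℕ) = 0 ∧ (b : ℕ) = 5) ∨
            ((b : ℕ) = 0 ∧ (a : ℕ) = 5)) := by
        revert a b
        decide
      rw [hcyc]
      constructor
      · intro h
        have := nbr a b (by omega) (by omega) h
        omega
      · intro h
        change G.Adj (p a) (p b)
        rcases h with h | h | h | h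
        · rw [← h]; exact (hadj b (by omega)).symm
        · rw [h]; exact hadj a (by omega)
        · rw [h.1, h.2]; exact h05
        · rw [h.1, h.2]; exact h05.symm
    refine ⟨{p 2}, red _ ?_, by rw [Finset.card_singleton]; omega⟩
    have d : ∀ i < n, ¬ dom G {p 2} (p i) → i = 0 ∨ i = 4 ∨ i = 5 := by
      intro i hi hd
      by_contra hcon
      have : i = 1 ∨ i = 2 ∨ i = 3 := by omega
      apply hd
      rcases this with rfl | rfl | rfl
      · exact Or.inr ⟨p 2, by simp, (hadj 1 (by omega)).symm⟩
      · exact Or.inl (by simp)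
      · exact Or.inr ⟨p 2, by simp, hadj 2 (by omega)⟩
    intro i hi j hj k hk hik hij hjk
    by_contra hcon
    push Not at hcon
    have d1 := d i hi hcon.1
    have d2 := d j hj hcon.2.1
    have d3 := d k hk hcon.2.2
    have n1 := nbr i j hi hj hij
    have n2 := nbr j k hj hk hjk
    have f : ∀ i j, G.Adj (p i) (p j) → ¬ (i = 0 ∧ j = 5) := by
      rintro i j h ⟨rfl, rfl⟩
      exact hnc h
    have f1 := f i j hij
    have f2 := f j i hij.symm
    have f3 := f j k hjk
    have f4 := f k j hjk.symm
    omega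
  -- general case
  refine ⟨(Finset.range ((n + 4) / 5)).image (fun j => p (min (5 * j + 2) (n - 1))), red _ ?_, ?_⟩
  · set D := (Finset.range ((n + 4) / 5)).image (fun j => p (min (5 * j + 2) (n - 1))) with hD
    have hmem : ∀ i < n, (i % 5 = 2 ∨ i + 1 = n ∧ i % 5 < 2) → p i ∈ D := by
      intro i hi h
      refine Finset.mem_image.2 ⟨i / 5, Finset.mem_range.2 (by omega), ?_⟩
      have : min (5 * (i / 5) + 2) (n - 1) = i := by omega
      simp only [this]
    have d : ∀ i < n, ¬ dom G D (p i) →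
        (i % 5 = 0 ∨ i % 5 = 4) ∧ ¬ (i + 1 = n ∧ i % 5 = 0) := by
      intro i hi hd
      by_contra hcon
      apply hd
      by_cases c1 : i % 5 = 2 ∨ i + 1 = n ∧ i % 5 < 2
      · exact Or.inl (hmem i hi c1)
      by_cases c2 : i % 5 = 1
      · exact Or.inr ⟨p (i + 1), hmem _ (by omega) (by omega), (hadj i (by omega)).symm⟩
      · refine Or.inr ⟨p (i - 1), hmem _ (by omega) (by omega), ?_⟩
        have := hadj (i - 1) (by omega)
        rwa [Nat.sub_add_cancel (by omega)] at this
    intro i hi j hj k hk hik hij hjk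
    by_contra hcon
    push Not at hcon
    have d1 := d i hi hcon.1
    have d2 := d j hj hcon.2.1
    have d3 := d k hk hcon.2.2
    have n1 := nbr i j hi hj hij
    have n2 := nbr j k hj hk hjk
    omega
  · have h1 : ((Finset.range ((n + 4) / 5)).image
        (fun j => p (min (5 * j + 2) (n - 1)))).card ≤ (n + 4) / 5 := by
      simpa using Finset.card_image_le (s := Finset.range ((n + 4) / 5))
        (f := fun j => p (min (5 * j + 2) (n - 1)))
    omega

lemma main (h6 : ¬ HasInducedC6 G) (n : ℕ) :
    ∀ S : Finset V, S.card = n → Conn G S → M G S ∧ R G S := by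
  induction n using Nat.strong_induction_on with
  | _ n ihn =>
    intro S hSn hS
    have ih : ∀ C, Conn G C → C.card < S.card → M G C ∧ R G C := fun C hC hlt =>
      ihn C.card (hSn ▸ hlt) C rfl hC
    refine ⟨?_, rooted hS ih⟩
    by_contra hn
    apply hn
    apply path_case h6 hS
    intro x hx a ha b hb c hc hxa hxb hxc
    by_contra hcon
    push Not at hcon
    exact no_claw hS ih hn hx ha hb hc hxa hxb hxc hcon.1 hcon.2.1 hcon.2.2

end P3Iso

theorem stmt_11 {V : Type*} [Fintype V] (G : SimpleGraph V)
    (hc : G.Connected) (h6 : ¬ HasInducedC6 G) :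
    iotaP3 G ≤ (Fintype.card V + 1) / 4 := by
  classical
  have hconn : P3Iso.Conn G (Finset.univ : Finset V) := by
    obtain ⟨v⟩ := hc.nonempty
    refine ⟨⟨v, Finset.mem_univ v⟩, ?_⟩
    intro A _ hA hne
    obtain ⟨a, ha⟩ := hA
    obtain ⟨b, hb⟩ : ∃ b, b ∉ A := by
      by_contra hcon
      push Not at hcon
      exact hne (Finset.eq_univ_iff_forall.2 hcon)
    obtain ⟨w⟩ := hc.preconnected a b
    obtain ⟨d, -, h1, h2⟩ := w.exists_boundary_dart (A : Set V) (by simpa using ha)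
      (by simpa using hb)
    exact ⟨d.fst, by simpa using h1, d.snd, Finset.mem_univ _, by simpa using h2, d.adj⟩
  obtain ⟨D, hD, hcard⟩ := (P3Iso.main h6 _ Finset.univ rfl hconn).1
  rw [Finset.card_univ] at hcard
  have hle : iotaP3 G ≤ D.card := by
    refine Nat.sInf_le ⟨(D : Set V), ?_, Set.ncard_coe_finset D⟩
    rintro ⟨f, hf⟩
    have e1 := hf 0 1 (by simp [SimpleGraph.pathGraph_adj])
    have e2 := hf 1 2 (by simp [SimpleGraph.pathGraph_adj])
    have hne : (f 0 : V) ≠ f 2 := by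
      intro h
      have := f.injective (Subtype.ext h)
      exact absurd this (by decide)
    have hdom : ∀ i, ¬ P3Iso.dom G D (f i) := by
      intro i h
      exact (f i).2 h
    rcases hD (f 0) (Finset.mem_univ _) (f 1) (Finset.mem_univ _) (f 2) (Finset.mem_univ _) hne
      e1 e2 with h | h | h
    · exact hdom _ h
    · exact hdom _ h
    · exact hdom _ h
  omega
end

section
/- If G is a connected n-vertex graph with no induced 6-cycles and ι(G, P_3) = (n+1)/4, then for every vertex v of G, ι(G−v, P_3) ≤ ι(G, P_3) − 1. -/
open SimpleGraph

section Helpers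
open Classical

namespace P3iso

variable {V : Type*}

/-- `a` is dominated by `D`. -/
def Dm (G : SimpleGraph V) (D : Finset V) (a : V) : Prop := a ∈ D ∨ ∃ d ∈ D, G.Adj d a

/-- every 3-path inside `A` is hit by the closed neighbourhood of `D`. -/
def Iso (G : SimpleGraph V) (A D : Finset V) : Prop :=
  ∀ a ∈ A, ∀ b ∈ A, ∀ c ∈ A, a ≠ c → G.Adj a b → G.Adj b c → Dm G D a ∨ Dm G D b ∨ Dm G D c

/-- `B` is a union of components of `G[A]`. -/
def Clo (G : SimpleGraph V) (A B : Finset V) : Prop :=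
  B ⊆ A ∧ ∀ a ∈ B, ∀ c ∈ A, G.Adj a c → c ∈ B

/-- `G[A]` is connected. -/
def Conn (G : SimpleGraph V) (A : Finset V) : Prop :=
  A.Nonempty ∧ ∀ B, Clo G A B → B.Nonempty → B = A

/-- the components of `G[A]`. -/
noncomputable def comps (G : SimpleGraph V) (A : Finset V) : Finset (Finset V) :=
  A.powerset.filter (fun C => Clo G A C ∧ Conn G C)

/-- `A` is extremal. -/
def Ext (G : SimpleGraph V) (A : Finset V) : Prop :=
  ∀ D ⊆ A, Iso G A D → A.card < 4 * D.card

/-- bound and criticality. -/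
def Good (G : SimpleGraph V) (A : Finset V) : Prop :=
  (∃ D ⊆ A, Iso G A D ∧ 4 * D.card ≤ A.card + 1) ∧
  (Ext G A → ∀ w ∈ A, ∃ D ⊆ A \ {w}, Iso G (A \ {w}) D ∧ 4 * D.card + 4 ≤ A.card + 1)

theorem mem_comps {G : SimpleGraph V} {A C : Finset V} :
    C ∈ comps G A ↔ Clo G A C ∧ Conn G C := by
  unfold comps
  rw [Finset.mem_filter, Finset.mem_powerset]
  exact ⟨fun h => h.2, fun h => ⟨h.1.1, h⟩⟩

theorem comps_eq {G : SimpleGraph V} {A C C' : Finset V} (h : C ∈ comps G A)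
    (h' : C' ∈ comps G A) {a : V} (ha : a ∈ C) (ha' : a ∈ C') : C = C' := by
  rw [mem_comps] at h h'
  have h1 : C ∩ C' = C := by
    apply h.2.2
    · refine ⟨Finset.inter_subset_left, fun x hx z hz hxz => ?_⟩
      rw [Finset.mem_inter] at hx ⊢
      exact ⟨hz, h'.1.2 x hx.2 z (h.1.1 hz) hxz⟩
    · exact ⟨a, Finset.mem_inter.2 ⟨ha, ha'⟩⟩
  have h2 : C ∩ C' = C' := by
    apply h'.2.2
    · refine ⟨Finset.inter_subset_right, fun x hx z hz hxz => ?_⟩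
      rw [Finset.mem_inter] at hx ⊢
      exact ⟨h.1.2 x hx.1 z (h'.1.1 hz) hxz, hz⟩
    · exact ⟨a, Finset.mem_inter.2 ⟨ha, ha'⟩⟩
  exact h1.symm.trans h2

theorem comps_cover {G : SimpleGraph V} {A : Finset V} {a : V} (ha : a ∈ A) :
    ∃ C ∈ comps G A, a ∈ C := by
  have hne : (A.powerset.filter (fun B => Clo G A B ∧ a ∈ B)).Nonempty :=
    ⟨A, Finset.mem_filter.2 ⟨by simp, ⟨subset_rfl, fun _ _ c hc _ => hc⟩, ha⟩⟩
  obtain ⟨C, hC, hmin⟩ := Finset.exists_min_image _ Finset.card hne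
  simp only [Finset.mem_filter, Finset.mem_powerset] at hC hmin
  obtain ⟨hCA, hC, haC⟩ := hC
  refine ⟨C, mem_comps.2 ⟨hC, ⟨a, haC⟩, fun B hB hBn => ?_⟩, haC⟩
  by_cases haB : a ∈ B
  · apply Finset.eq_of_subset_of_card_le hB.1
    apply hmin
    refine ⟨hB.1.trans hCA, ⟨hB.1.trans hCA, fun x hx z hz hxz => ?_⟩, haB⟩
    exact hB.2 x hx z (hC.2 x (hB.1 hx) z hz hxz) hxz
  · exfalso
    have h1 : C.card ≤ (C \ B).card := by
      apply hmin
      refine ⟨Finset.sdiff_subset.trans hCA,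
        ⟨Finset.sdiff_subset.trans hCA, fun x hx z hz hxz => ?_⟩, by simp [haC, haB]⟩
      rw [Finset.mem_sdiff] at hx ⊢
      refine ⟨hC.2 x hx.1 z hz hxz, fun hzB => hx.2 (hB.2 z hzB x hx.1 hxz.symm)⟩
    have h2 := Finset.card_sdiff_add_card_eq_card hB.1
    have h3 := hBn.card_pos
    omega

theorem comps_card (G : SimpleGraph V) (A : Finset V) :
    ∑ C ∈ comps G A, C.card = A.card := by
  have h : A = (comps G A).biUnion id := by
    ext a
    simp only [Finset.mem_biUnion, id]
    constructor
    · exact fun ha => comps_cover ha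
    · rintro ⟨C, hC, ha⟩
      exact (mem_comps.1 hC).1.1 ha
  conv_rhs => rw [h]
  rw [Finset.card_biUnion]
  · rfl
  · intro C hC C' hC' hne
    rw [Function.onFun, Finset.disjoint_left]
    intro a ha ha'
    exact hne (comps_eq hC hC' ha ha')

theorem Dm.mono {G : SimpleGraph V} {D D' : Finset V} (h : D ⊆ D') {a : V} (ha : Dm G D a) :
    Dm G D' a := by
  rcases ha with ha | ⟨d, hd, ha⟩
  · exact Or.inl (h ha)
  · exact Or.inr ⟨d, h hd, ha⟩

/-- gluing lemma -/
theorem glue {G : SimpleGraph V} {A X D0 : Finset V} (hXA : X ⊆ A) (hD0 : D0 ⊆ A)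
    (hX : ∀ a ∈ A, ∀ b ∈ A, ∀ c ∈ A, a ≠ c → G.Adj a b → G.Adj b c → ¬ Dm G D0 a →
      ¬ Dm G D0 b → ¬ Dm G D0 c → a ∉ X ∧ b ∉ X ∧ c ∉ X)
    (hgood : ∀ C ∈ comps G (A \ X), Good G C) :
    ∃ D ⊆ A, Iso G A D ∧
      4 * D.card + 4 * ((comps G (A \ X)).filter
          (fun C => Ext G C ∧ ∃ w ∈ C, Dm G D0 w)).card + X.card
        ≤ 4 * D0.card + A.card + ((comps G (A \ X)).filter (fun C => Ext G C)).card := by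
  have key : ∀ C, ∃ D, C ∈ comps G (A \ X) → (D ⊆ C ∧
      (∀ a ∈ C, ∀ b ∈ C, ∀ c ∈ C, a ≠ c → G.Adj a b → G.Adj b c → ¬ Dm G D0 a →
      ¬ Dm G D0 b → ¬ Dm G D0 c → Dm G D a ∨ Dm G D b ∨ Dm G D c) ∧
      4 * D.card + 4 * (if Ext G C ∧ ∃ w ∈ C, Dm G D0 w then 1 else 0) ≤
        C.card + (if Ext G C then 1 else 0)) := by
    intro C
    by_cases hC : C ∈ comps G (A \ X)
    swap
    · exact ⟨∅, fun h => absurd h hC⟩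
    obtain ⟨g1, g2⟩ := hgood C hC
    by_cases hE : Ext G C
    · by_cases hw : ∃ w ∈ C, Dm G D0 w
      · obtain ⟨w, hwC, hw'⟩ := hw
        obtain ⟨D, hD, hi, hc⟩ := g2 hE w hwC
        refine ⟨D, fun _ => ⟨hD.trans Finset.sdiff_subset, ?_, ?_⟩⟩
        · intro a ha b hb c hcc hac hab hbc na nb nc
          have aux : ∀ z ∈ C, ¬ Dm G D0 z → z ∈ C \ {w} := by
            intro z hz nz
            simp only [Finset.mem_sdiff, Finset.mem_singleton]
            exact ⟨hz, fun h => nz (h ▸ hw')⟩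
          exact hi a (aux a ha na) b (aux b hb nb) c (aux c hcc nc) hac hab hbc
        · rw [if_pos ⟨hE, w, hwC, hw'⟩, if_pos hE]; omega
      · obtain ⟨D, hD, hi, hc⟩ := g1
        refine ⟨D, fun _ => ⟨hD, fun a ha b hb c hc hac hab hbc _ _ _ =>
          hi a ha b hb c hc hac hab hbc, ?_⟩⟩
        rw [if_neg (fun h => hw h.2), if_pos hE]; omega
    · have hE' := hE
      unfold Ext at hE'
      push Not at hE'
      obtain ⟨D, hD, hi, hc⟩ := hE'
      refine ⟨D, fun _ => ⟨hD, fun a ha b hb c hc hac hab hbc _ _ _ =>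
          hi a ha b hb c hc hac hab hbc, ?_⟩⟩
      rw [if_neg (fun h => hE h.1), if_neg hE]; omega
  choose F hF using key
  have hsub : ∀ C ∈ comps G (A \ X), C ⊆ A \ X := fun C hC => (mem_comps.1 hC).1.1
  refine ⟨D0 ∪ (comps G (A \ X)).biUnion F, ?_, ?_, ?_⟩
  · apply Finset.union_subset hD0
    rw [Finset.biUnion_subset]
    intro C hC
    exact ((hF C hC).1.trans (hsub C hC)).trans Finset.sdiff_subset
  · intro a ha b hb c hc hac hab hbc
    by_contra hcon
    push Not at hcon
    obtain ⟨na, nb, nc⟩ := hcon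
    have n0 : ∀ z, ¬ Dm G (D0 ∪ (comps G (A \ X)).biUnion F) z → ¬ Dm G D0 z :=
      fun z hz h => hz (h.mono Finset.subset_union_left)
    obtain ⟨xa, xb, xc⟩ := hX a ha b hb c hc hac hab hbc (n0 a na) (n0 b nb) (n0 c nc)
    obtain ⟨C, hC, hbC⟩ := comps_cover (G := G) (Finset.mem_sdiff.2 ⟨hb, xb⟩)
    have hClo := (mem_comps.1 hC).1
    have haC := hClo.2 b hbC a (Finset.mem_sdiff.2 ⟨ha, xa⟩) hab.symm
    have hcC := hClo.2 b hbC c (Finset.mem_sdiff.2 ⟨hc, xc⟩) hbc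
    have hs : F C ⊆ D0 ∪ (comps G (A \ X)).biUnion F :=
      (Finset.subset_biUnion_of_mem F hC).trans Finset.subset_union_right
    rcases (hF C hC).2.1 a haC b hbC c hcC hac hab hbc (n0 a na) (n0 b nb) (n0 c nc) with h | h | h
    · exact na (h.mono hs)
    · exact nb (h.mono hs)
    · exact nc (h.mono hs)
  · have h1 : (D0 ∪ (comps G (A \ X)).biUnion F).card ≤
        D0.card + ∑ C ∈ comps G (A \ X), (F C).card :=
      (Finset.card_union_le _ _).trans (Nat.add_le_add_left Finset.card_biUnion_le _)
    have h2 := Finset.sum_le_sum (fun C hC => (hF C hC).2.2)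
    rw [Finset.sum_add_distrib, Finset.sum_add_distrib, ← Finset.mul_sum, ← Finset.mul_sum,
      ← Finset.card_filter, ← Finset.card_filter, comps_card] at h2
    have h3 := Finset.card_sdiff_add_card_eq_card hXA
    omega

/-- combinatorial lemma for the greedy choice -/
theorem greedy {α β : Type*} (N : Finset α) (E : Finset β) (R : α → β → Prop)
    (hN : 3 ≤ N.card) (hR : ∀ C ∈ E, ∀ x ∈ N, ∃ y ∈ N, y ≠ x ∧ R y C) :
    ∃ S ⊆ N, 4 * S.card + 2 + E.card ≤ N.card + 4 * (E.filter (fun C => ∃ x ∈ S, R x C)).card := by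
  have hne : (N.powerset.filter
      (fun S => 2 * S.card ≤ (E.filter (fun C => ∃ x ∈ S, R x C)).card)).Nonempty :=
    ⟨∅, by simp⟩
  obtain ⟨S, hS, hmax⟩ := Finset.exists_max_image _ Finset.card hne
  simp only [Finset.mem_filter, Finset.mem_powerset] at hS hmax
  obtain ⟨hSN, hS⟩ := hS
  refine ⟨S, hSN, ?_⟩
  set H := E.filter (fun C => ∃ x ∈ S, R x C) with hH
  set Q := E.filter (fun C => ¬ ∃ x ∈ S, R x C) with hQ
  have hHQ : H.card + Q.card = E.card := Finset.card_filter_add_card_filter_not _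
  have hdc : Q.card * 2 ≤ N.card * 1 := by
    apply Finset.card_mul_le_card_mul (fun C x => R x C)
    · intro C hC
      rw [hQ, Finset.mem_filter] at hC
      have hN0 : 0 < N.card := by omega
      obtain ⟨x0, hx0⟩ := Finset.card_pos.1 hN0
      obtain ⟨y, hy, -, hyR⟩ := hR C hC.1 x0 hx0
      obtain ⟨z, hz, hzy, hzR⟩ := hR C hC.1 y hy
      have : 1 < (Finset.bipartiteAbove (fun C x => R x C) N C).card := by
        rw [Finset.one_lt_card]
        exact ⟨z, by simp [Finset.bipartiteAbove, hz, hzR], y,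
          by simp [Finset.bipartiteAbove, hy, hyR], hzy⟩
      omega
    · intro x hx
      by_contra hlt
      push Not at hlt
      have hxS : x ∉ S := by
        intro hxS
        obtain ⟨C, hC⟩ := Finset.card_pos.1 (lt_trans Nat.zero_lt_one hlt)
        simp only [Finset.bipartiteBelow, Finset.mem_filter, hQ] at hC
        exact hC.1.2 ⟨x, hxS, hC.2⟩
      have h1 := hmax (insert x S)
      rw [Finset.card_insert_of_notMem hxS] at h1
      have h2 : H ∪ Finset.bipartiteBelow (fun C x => R x C) Q x ⊆
          E.filter (fun C => ∃ y ∈ insert x S, R y C) := by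
        intro C hC
        simp only [Finset.mem_union, hH, hQ, Finset.bipartiteBelow, Finset.mem_filter] at hC
        simp only [Finset.mem_filter, Finset.mem_insert]
        rcases hC with ⟨h, y, hy, hyR⟩ | ⟨⟨h, -⟩, hr⟩
        · exact ⟨h, y, Or.inr hy, hyR⟩
        · exact ⟨h, x, Or.inl rfl, hr⟩
      have h3 := Finset.card_le_card h2
      rw [Finset.card_union_of_disjoint] at h3
      · have := h1 ⟨Finset.insert_subset hx hSN, by omega⟩
        omega
      · rw [Finset.disjoint_left]
        intro C hC hC'
        simp only [hH, hQ, Finset.bipartiteBelow, Finset.mem_filter] at hC hC'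
        exact hC'.1.2 hC.2
  omega

/-- no extremal component after deleting one vertex, unless the bound `|A|/4` holds -/
theorem del_vertex {G : SimpleGraph V} {A : Finset V} (hA : Conn G A)
    (IH : ∀ B, B.card < A.card → Conn G B → Good G B) {x : V} (hx : x ∈ A)
    (hex : ∃ C ∈ comps G (A \ {x}), Ext G C) :
    ∃ D ⊆ A, Iso G A D ∧ 4 * D.card ≤ A.card := by
  have hx' : ({x} : Finset V) ⊆ A := by simpa using hx
  have hcard := Finset.card_sdiff_add_card_eq_card hx'
  rw [Finset.card_singleton] at hcard
  obtain ⟨D, hD, hi, hc⟩ := glue (G := G) hx' hx' (by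
      intro a _ b _ c _ _ _ _ na nb nc
      simp only [Dm, Finset.mem_singleton] at *
      tauto) (by
      intro C hC
      rw [mem_comps] at hC
      apply IH C _ hC.2
      have := Finset.card_le_card hC.1.1
      omega)
  refine ⟨D, hD, hi, ?_⟩
  have heq : (comps G (A \ {x})).filter (fun C => Ext G C ∧ ∃ w ∈ C, Dm G {x} w) =
      (comps G (A \ {x})).filter (fun C => Ext G C) := by
    apply Finset.filter_congr
    intro C hC
    refine ⟨fun h => h.1, fun h => ⟨h, ?_⟩⟩
    by_contra hcon
    push Not at hcon
    rw [mem_comps] at hC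
    have hCA : C = A := by
      apply hA.2 C _ hC.2.1
      refine ⟨hC.1.1.trans Finset.sdiff_subset, fun a ha c hcA hac => ?_⟩
      by_cases hcx : c = x
      · exfalso
        exact hcon a ha (Or.inr ⟨x, by simp, hcx ▸ hac.symm⟩)
      · exact hC.1.2 a ha c (by simp [hcA, hcx]) hac
    have := hC.1.1 (hCA ▸ hx)
    simp at this
  rw [heq] at hc
  have hpos : 0 < ((comps G (A \ {x})).filter (fun C => Ext G C)).card := by
    obtain ⟨C, hC, hE⟩ := hex
    exact Finset.card_pos.2 ⟨C, by simp [hC, hE]⟩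
  simp only [Finset.card_singleton] at hc
  omega

theorem critical {G : SimpleGraph V} {A : Finset V} (hA : Conn G A)
    (IH : ∀ B, B.card < A.card → Conn G B → Good G B)
    (h1 : ∃ D ⊆ A, Iso G A D ∧ 4 * D.card ≤ A.card + 1) (hE : Ext G A) (w : V) (hw : w ∈ A) :
    ∃ D ⊆ A \ {w}, Iso G (A \ {w}) D ∧ 4 * D.card + 4 ≤ A.card + 1 := by
  have hx' : ({w} : Finset V) ⊆ A := by simpa using hw
  have hcard := Finset.card_sdiff_add_card_eq_card hx'
  rw [Finset.card_singleton] at hcard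
  have hno : ¬ ∃ C ∈ comps G (A \ {w}), Ext G C := by
    intro h
    obtain ⟨D, hD, hi, hc⟩ := del_vertex hA IH hw h
    have := hE D hD hi
    omega
  obtain ⟨D, hD, hi, hc⟩ := glue (G := G) (A := A \ {w}) (X := ∅) (D0 := ∅) (by simp) (by simp)
    (by simp) (by
      intro C hC
      rw [mem_comps] at hC
      apply IH C _ hC.2
      have := Finset.card_le_card hC.1.1
      rw [Finset.sdiff_empty] at this
      omega)
  rw [Finset.sdiff_empty] at hc
  have h0 : ((comps G (A \ {w})).filter (fun C => Ext G C)).card = 0 := by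
    rw [Finset.card_eq_zero, Finset.filter_eq_empty_iff]
    intro C hC hC'
    exact hno ⟨C, hC, hC'⟩
  refine ⟨D, hD, hi, ?_⟩
  obtain ⟨D1, hD1, hi1, hc1⟩ := h1
  have := hE D1 hD1 hi1
  simp only [Finset.card_empty] at hc
  omega

/-- every extremal component of `A \ X` is linked to at least two vertices of `X` -/
theorem link {G : SimpleGraph V} {A : Finset V} (hA : Conn G A)
    (IH : ∀ B, B.card < A.card → Conn G B → Good G B)
    (hno : ¬ ∃ D ⊆ A, Iso G A D ∧ 4 * D.card ≤ A.card + 1)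
    {X C : Finset V} (hXA : X ⊆ A) (hC : C ∈ comps G (A \ X)) (hE : Ext G C) {x : V} (hx : x ∈ X) :
    ∃ y ∈ X, y ≠ x ∧ ∃ w ∈ C, G.Adj y w := by
  by_contra hcon
  push Not at hcon
  rw [mem_comps] at hC
  have : C ∈ comps G (A \ {x}) := by
    refine mem_comps.2 ⟨⟨fun c hc => ?_, fun a ha c hc hac => ?_⟩, hC.2⟩
    · have := hC.1.1 hc
      simp only [Finset.mem_sdiff, Finset.mem_singleton] at this ⊢
      exact ⟨this.1, fun h => this.2 (h ▸ hx)⟩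
    · simp only [Finset.mem_sdiff, Finset.mem_singleton] at hc
      by_cases hcX : c ∈ X
      · exact absurd hac.symm (hcon c hcX hc.2 a ha)
      · exact hC.1.2 a ha c (by simp [hc.1, hcX]) hac
  obtain ⟨D, hD, hi, hc⟩ := del_vertex hA IH (hXA hx) ⟨C, this, hE⟩
  exact hno ⟨D, hD, hi, by omega⟩

theorem comps_good {G : SimpleGraph V} {A : Finset V}
    (IH : ∀ B, B.card < A.card → Conn G B → Good G B) {X : Finset V} (hXA : X ⊆ A)
    (hX : X.Nonempty) : ∀ C ∈ comps G (A \ X), Good G C := by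
  intro C hC
  rw [mem_comps] at hC
  apply IH C _ hC.2
  have := Finset.card_le_card hC.1.1
  have := Finset.card_sdiff_add_card_eq_card hXA
  have := hX.card_pos
  omega

/-- a vertex of degree at least 3 -/
theorem big_degree {G : SimpleGraph V} {A : Finset V} (hA : Conn G A)
    (IH : ∀ B, B.card < A.card → Conn G B → Good G B) {v : V} (hv : v ∈ A)
    (hd : 3 ≤ (A.filter (fun x => G.Adj v x)).card) :
    ∃ D ⊆ A, Iso G A D ∧ 4 * D.card ≤ A.card + 1 := by
  by_contra hno
  set N := A.filter (fun x => G.Adj v x) with hN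
  have hvN : v ∉ N := by simp [hN]
  have hXA : insert v N ⊆ A := Finset.insert_subset hv (Finset.filter_subset _ _)
  set E := (comps G (A \ insert v N)).filter (fun C => Ext G C) with hE
  obtain ⟨S, hSN, hS⟩ := greedy N E (fun x C => ∃ w ∈ C, G.Adj x w) hd (by
    intro C hC x hx
    rw [hE, Finset.mem_filter] at hC
    obtain ⟨y, hy, hyx, w, hw, hyw⟩ :=
      link hA IH hno hXA hC.1 hC.2 (x := x) (Finset.mem_insert_of_mem hx)
    rcases Finset.mem_insert.1 hy with rfl | hy
    · exfalso
      have := (mem_comps.1 hC.1).1.1 hw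
      simp only [hN, Finset.mem_sdiff, Finset.mem_insert, Finset.mem_filter] at this
      tauto
    · exact ⟨y, hy, hyx, w, hw, hyw⟩)
  have hS' : insert v S ⊆ insert v N := Finset.insert_subset_insert v hSN
  obtain ⟨D, hD, hi, hc⟩ := glue (G := G) hXA (hS'.trans hXA) (by
    have aux : ∀ z, ¬ Dm G (insert v S) z → z ∉ insert v N := by
      intro z hz hzX
      apply hz
      rcases Finset.mem_insert.1 hzX with rfl | hzN
      · exact Or.inl (by simp)
      · exact Or.inr ⟨v, by simp, (Finset.mem_filter.1 hzN).2⟩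
    intro a _ b _ c _ _ _ _ na nb nc
    exact ⟨aux a na, aux b nb, aux c nc⟩) (comps_good IH hXA ⟨v, by simp⟩)
  apply hno
  refine ⟨D, hD, hi, ?_⟩
  have h1 : (E.filter (fun C => ∃ x ∈ S, ∃ w ∈ C, G.Adj x w)).card ≤
      ((comps G (A \ insert v N)).filter
        (fun C => Ext G C ∧ ∃ w ∈ C, Dm G (insert v S) w)).card := by
    apply Finset.card_le_card
    intro C hC
    simp only [hE, Finset.mem_filter] at hC ⊢
    obtain ⟨⟨hC, hCE⟩, x, hx, w, hw, hxw⟩ := hC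
    exact ⟨hC, hCE, w, hw, Or.inr ⟨x, by simp [hx], hxw⟩⟩
  rw [Finset.card_insert_of_notMem hvN] at hc
  have h2 := Finset.card_insert_le v S
  rw [← hE] at hc
  have hS2 : 4 * S.card + 2 + E.card ≤
      N.card + 4 * (E.filter (fun C => ∃ x ∈ S, ∃ w ∈ C, G.Adj x w)).card := by
    convert hS
  omega

theorem deg2 {G : SimpleGraph V} {A : Finset V}
    (hdeg : ∀ v ∈ A, (A.filter (fun x => G.Adj v x)).card ≤ 2) {v x y z : V} (hv : v ∈ A)
    (hx : x ∈ A) (hy : y ∈ A) (hz : z ∈ A) (hvx : G.Adj v x) (hvy : G.Adj v y) (hvz : G.Adj v z)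
    (hxy : x ≠ y) : z = x ∨ z = y := by
  by_contra hcon
  push Not at hcon
  have h1 : ({z, x, y} : Finset V) ⊆ A.filter (fun x => G.Adj v x) := by
    intro a ha
    simp only [Finset.mem_insert, Finset.mem_singleton] at ha
    rcases ha with rfl | rfl | rfl <;> simp [*]
  have h2 := Finset.card_le_card h1
  rw [Finset.card_eq_three.2 ⟨z, x, y, hcon.1, hcon.2, hxy, rfl⟩] at h2
  have := hdeg v hv
  omega

/-- cardinality at most one for families of components meeting a common vertex -/
theorem ext_le_one {G : SimpleGraph V} {B : Finset V} {x' : V}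
    (h : ∀ C ∈ comps G B, Ext G C → x' ∈ C) :
    ((comps G B).filter (fun C => Ext G C)).card ≤ 1 := by
  rw [Finset.card_le_one]
  intro C hC C' hC'
  rw [Finset.mem_filter] at hC hC'
  exact comps_eq hC.1 hC'.1 (h C hC.1 hC.2) (h C' hC'.1 hC'.2)

/-- local step in the case of maximum degree two -/
theorem step {G : SimpleGraph V} {A : Finset V} (hA : Conn G A)
    (IH : ∀ B, B.card < A.card → Conn G B → Good G B)
    (hno : ¬ ∃ D ⊆ A, Iso G A D ∧ 4 * D.card ≤ A.card + 1)
    (hdeg : ∀ v ∈ A, (A.filter (fun x => G.Adj v x)).card ≤ 2) {v x y : V} (hv : v ∈ A)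
    (hx : x ∈ A) (hy : y ∈ A) (hvx : G.Adj v x) (hvy : G.Adj v y) (hxy : x ≠ y) :
    (∃ x' ∈ A, x' ≠ v ∧ G.Adj x x') ∧ A.card % 4 = 2 := by
  have hXA : ({v, x, y} : Finset V) ⊆ A := by
    intro a ha
    simp only [Finset.mem_insert, Finset.mem_singleton] at ha
    rcases ha with rfl | rfl | rfl <;> assumption
  have hXc : ({v, x, y} : Finset V).card = 3 :=
    Finset.card_eq_three.2 ⟨v, x, y, hvx.ne, hvy.ne, hxy, rfl⟩
  obtain ⟨D, hD, hi, hc⟩ := glue (G := G) (D0 := {v}) hXA (by simpa using hv) (by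
    have aux : ∀ z, ¬ Dm G {v} z → z ∉ ({v, x, y} : Finset V) := by
      intro z hz hzX
      apply hz
      simp only [Finset.mem_insert, Finset.mem_singleton] at hzX
      rcases hzX with rfl | rfl | rfl
      · exact Or.inl (by simp)
      · exact Or.inr ⟨v, by simp, hvx⟩
      · exact Or.inr ⟨v, by simp, hvy⟩
    intro a _ b _ c _ _ _ _ na nb nc
    exact ⟨aux a na, aux b nb, aux c nc⟩) (comps_good IH hXA ⟨v, by simp⟩)
  have hlt : A.card + 1 < 4 * D.card := by
    by_contra h
    exact hno ⟨D, hD, hi, by omega⟩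
  rw [hXc, Finset.card_singleton] at hc
  -- every extremal component is linked to x
  have hl : ∀ C ∈ comps G (A \ {v, x, y}), Ext G C → ∃ w ∈ C, G.Adj x w := by
    intro C hC hE
    obtain ⟨u, hu, huy, w, hw, huw⟩ := link hA IH hno hXA hC hE (x := y) (by simp)
    have hwC := (mem_comps.1 hC).1.1 hw
    simp only [Finset.mem_insert, Finset.mem_singleton, Finset.mem_sdiff] at hu hwC
    rcases hu with rfl | rfl | rfl
    · rcases deg2 hdeg hv hx hy hwC.1 hvx hvy huw hxy with h | h <;> tauto
    · exact ⟨w, hw, huw⟩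
    · exact absurd rfl huy
  have hpos : 0 < ((comps G (A \ {v, x, y})).filter (fun C => Ext G C)).card := by omega
  obtain ⟨C, hC⟩ := Finset.card_pos.1 hpos
  rw [Finset.mem_filter] at hC
  obtain ⟨w, hw, hxw⟩ := hl C hC.1 hC.2
  have hwC := (mem_comps.1 hC.1).1.1 hw
  simp only [Finset.mem_insert, Finset.mem_singleton, Finset.mem_sdiff, not_or] at hwC
  refine ⟨⟨w, hwC.1, hwC.2.1, hxw⟩, ?_⟩
  have hle : ((comps G (A \ {v, x, y})).filter (fun C => Ext G C)).card ≤ 1 := by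
    apply ext_le_one (x' := w)
    intro C' hC' hE'
    obtain ⟨w', hw', hxw'⟩ := hl C' hC' hE'
    have hwC' := (mem_comps.1 hC').1.1 hw'
    simp only [Finset.mem_insert, Finset.mem_singleton, Finset.mem_sdiff, not_or] at hwC'
    rcases deg2 hdeg hx hv hwC.1 hwC'.1 hvx.symm hxw hxw' (Ne.symm hwC.2.1) with h | h
    · exact absurd h hwC'.2.1
    · exact h ▸ hw'
  omega

/-- the sequence walking along the cycle -/
theorem walk {G : SimpleGraph V} {A : Finset V} (hA : Conn G A)
    (IH : ∀ B, B.card < A.card → Conn G B → Good G B)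
    (hno : ¬ ∃ D ⊆ A, Iso G A D ∧ 4 * D.card ≤ A.card + 1)
    (hdeg : ∀ v ∈ A, (A.filter (fun x => G.Adj v x)).card ≤ 2) {v x y : V} (hv : v ∈ A)
    (hx : x ∈ A) (hy : y ∈ A) (hvx : G.Adj v x) (hvy : G.Adj v y) (hxy : x ≠ y) :
    ∃ p : ℕ → V, p 0 = v ∧ p 1 = x ∧ (∀ i, p i ∈ A) ∧ (∀ i, G.Adj (p i) (p (i + 1))) ∧
      (∀ i, p (i + 2) ≠ p i) := by
  let T := {q : V × V // q.1 ∈ A ∧ q.2 ∈ A ∧ G.Adj q.1 q.2 ∧ ∃ c ∈ A, c ≠ q.1 ∧ G.Adj q.2 c}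
  have nxt : ∀ t : T, ∃ t' : T, t'.1.1 = t.1.2 ∧ t'.1.2 ≠ t.1.1 := by
    rintro ⟨⟨a, b⟩, ha, hb, hab, c, hc, hca, hbc⟩
    obtain ⟨d, hd, hdb, hcd⟩ := (step hA IH hno hdeg hb hc ha hbc hab.symm hca).1
    exact ⟨⟨(b, c), hb, hc, hbc, d, hd, hdb, hcd⟩, rfl, hca⟩
  choose f hf1 hf2 using nxt
  let t0 : T := ⟨(v, x), hv, hx, hvx, (step hA IH hno hdeg hv hx hy hvx hvy hxy).1⟩
  have hs : ∀ i, (f^[i + 1] t0) = f (f^[i] t0) := fun i => Function.iterate_succ_apply' f i t0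
  have h1 : ∀ i, (f^[i + 1] t0).1.1 = (f^[i] t0).1.2 := fun i => by rw [hs, hf1]
  refine ⟨fun i => (f^[i] t0).1.1, rfl, h1 0, fun i => (f^[i] t0).2.1, fun i => ?_, fun i => ?_⟩
  · have := (f^[i] t0).2.2.2.1
    rw [← h1] at this
    exact this
  · have := hf2 (f^[i] t0)
    rw [← hs, ← h1] at this
    exact this

/-- the walk is injective until it covers everything -/
theorem walk_inj {G : SimpleGraph V} {A : Finset V} (hA : Conn G A)
    (hdeg : ∀ v ∈ A, (A.filter (fun x => G.Adj v x)).card ≤ 2)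
    {p : ℕ → V} (hp : ∀ i, p i ∈ A) (hadj : ∀ i, G.Adj (p i) (p (i + 1)))
    (hne : ∀ i, p (i + 2) ≠ p i) :
    ∀ k, k < A.card → ∀ j ≤ k, ∀ i < j, p i ≠ p j := by
  have nb : ∀ i, ∀ z ∈ A, G.Adj (p (i + 1)) z → z = p i ∨ z = p (i + 2) := fun i z hz h =>
    deg2 hdeg (hp (i + 1)) (hp i) (hp (i + 2)) hz (hadj i).symm (hadj (i + 1)) h (hne i).symm
  intro k
  induction k with
  | zero => intro _ j hj i hi; omega
  | succ k ih =>
    intro hk j hj i hi heq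
    have ih := ih (by omega)
    rcases Nat.lt_or_ge j (k + 1) with hjk | hjk
    · exact ih j (by omega) i hi heq
    have : j = k + 1 := by omega
    subst this
    -- p i = p (k+1)
    have hik : i ≠ k := by
      rintro rfl
      exact (hadj i).ne heq
    obtain ⟨m, rfl⟩ : ∃ m, k = m + 1 := ⟨k - 1, by omega⟩
    have him : i ≠ m := by
      rintro rfl
      exact hne i heq.symm
    have ha : G.Adj (p i) (p (m + 1)) := heq ▸ (hadj (m + 1)).symm
    rcases Nat.eq_zero_or_pos i with rfl | hi0
    · -- closed set
      have hsub : (Finset.range (m + 2)).image p ⊆ A := by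
        intro z hz
        obtain ⟨l, -, rfl⟩ := Finset.mem_image.1 hz
        exact hp l
      have hcl : (Finset.range (m + 2)).image p = A := by
        apply hA.2
        · refine ⟨hsub, fun a haa c hc hac => ?_⟩
          obtain ⟨l, hl, rfl⟩ := Finset.mem_image.1 haa
          rw [Finset.mem_range] at hl
          rw [Finset.mem_image]
          rcases Nat.eq_zero_or_pos l with rfl | hl0
          · rcases deg2 hdeg (hp 0) (hp 1) (hp (m + 1)) hc (hadj 0) ha hac
              (ih (m + 1) le_rfl 1 (by omega)) with h | h
            · exact ⟨1, by simp, h.symm⟩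
            · exact ⟨m + 1, by simp, h.symm⟩
          · obtain ⟨l, rfl⟩ : ∃ l', l = l' + 1 := ⟨l - 1, by omega⟩
            rcases nb l c hc hac with h | h
            · exact ⟨l, by simp; omega, h.symm⟩
            · rcases Nat.lt_or_ge (l + 2) (m + 2) with h' | h'
              · exact ⟨l + 2, by simpa using h', h.symm⟩
              · have : l = m := by omega
                subst this
                exact ⟨0, by simp, by rw [h, heq]⟩
        · exact ⟨p 0, Finset.mem_image.2 ⟨0, by simp, rfl⟩⟩
      have := Finset.card_image_le (s := Finset.range (m + 2)) (f := p)
      rw [hcl, Finset.card_range] at this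
      omega
    · obtain ⟨l, rfl⟩ : ∃ l', i = l' + 1 := ⟨i - 1, by omega⟩
      rcases nb l (p (m + 1)) (hp _) ha with h | h
      · exact ih (m + 1) le_rfl l (by omega) h.symm
      · exact ih (m + 1) le_rfl (l + 2) (by omega) h.symm

theorem small_degree {G : SimpleGraph V} (h6 : ¬ HasInducedC6 G) {A : Finset V} (hA : Conn G A)
    (IH : ∀ B, B.card < A.card → Conn G B → Good G B)
    (hdeg : ∀ v ∈ A, (A.filter (fun x => G.Adj v x)).card ≤ 2) :
    ∃ D ⊆ A, Iso G A D ∧ 4 * D.card ≤ A.card + 1 := by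
  by_contra hno
  have hP : ¬ Iso G A ∅ := fun h => hno ⟨∅, by simp, h, by simp⟩
  unfold Iso at hP
  push Not at hP
  obtain ⟨x, hx, v, hv, y, hy, hxy, hxv, hvy, -⟩ := hP
  have hvx := hxv.symm
  have hmod := (step hA IH hno hdeg hv hx hy hvx hvy hxy).2
  have hXA : ({v, x, y} : Finset V) ⊆ A := by
    intro a ha
    simp only [Finset.mem_insert, Finset.mem_singleton] at ha
    rcases ha with rfl | rfl | rfl <;> assumption
  have hXc : ({v, x, y} : Finset V).card = 3 :=
    Finset.card_eq_three.2 ⟨v, x, y, hvx.ne, hvy.ne, hxy, rfl⟩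
  have h3 := Finset.card_le_card hXA
  obtain ⟨p, hp0, hp1, hp, hadj, hne⟩ := walk hA IH hno hdeg hv hx hy hvx hvy hxy
  have inj := walk_inj hA hdeg hp hadj hne
  have nb : ∀ i, ∀ z ∈ A, G.Adj (p (i + 1)) z → z = p i ∨ z = p (i + 2) := fun i z hz h =>
    deg2 hdeg (hp (i + 1)) (hp i) (hp (i + 2)) hz (hadj i).symm (hadj (i + 1)) h (hne i).symm
  subst hp0 hp1
  have hcases : A.card = 6 ∨ 8 ≤ A.card := by omega
  -- adjacency among the initial segment
  have nadj : ∀ k, k < A.card → ∀ j < k, ∀ i, i + 2 ≤ j → ¬ G.Adj (p i) (p j) := by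
    intro k hk j hj i hij h
    obtain ⟨l, rfl⟩ : ∃ l, j = l + 1 := ⟨j - 1, by omega⟩
    rcases nb l (p i) (hp i) h.symm with h' | h'
    · exact inj k hk l (by omega) i (by omega) h'
    · exact inj k hk (l + 2) (by omega) i (by omega) h'
  have himg : ∀ k, k < A.card → ((Finset.range (k + 1)).image p).card = k + 1 := by
    intro k hk
    rw [Finset.card_image_of_injOn, Finset.card_range]
    intro i hi j hj hij
    simp only [Finset.coe_range, Set.mem_Iio] at hi hj
    rcases lt_trichotomy i j with h | h | h
    · exact absurd hij (inj k hk j (by omega) i h)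
    · exact h
    · exact absurd hij.symm (inj k hk i (by omega) j h)
  have hsub : ∀ k, (Finset.range (k + 1)).image p ⊆ A := by
    intro k z hz
    obtain ⟨l, -, rfl⟩ := Finset.mem_image.1 hz
    exact hp l
  rcases hcases with hc6 | hc8
  · apply h6
    have hin := inj 5 (by omega)
    have hna := nadj 5 (by omega)
    have hAeq : (Finset.range 6).image p = A :=
      Finset.eq_of_subset_of_card_le (hsub 5) (by rw [himg 5 (by omega)]; omega)
    have h05 : G.Adj (p 0) (p 5) := by
      rw [← hAeq] at hy
      obtain ⟨j, hj, rfl⟩ := Finset.mem_image.1 hy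
      rw [Finset.mem_range] at hj
      have : j ≠ 0 := by rintro rfl; exact hvy.ne rfl
      have : j ≠ 1 := by rintro rfl; exact hxy rfl
      rcases Nat.lt_or_ge j 5 with h | h
      · exact absurd hvy (hna j h 0 (by omega))
      · have : j = 5 := by omega
        exact this ▸ hvy
    have n15 : ¬ G.Adj (p 1) (p 5) := by
      intro h
      rcases nb 0 (p 5) (hp 5) h with h | h
      · exact hin 5 le_rfl 0 (by omega) h.symm
      · exact hin 5 le_rfl 2 (by omega) h.symm
    have n25 : ¬ G.Adj (p 2) (p 5) := by
      intro h
      rcases nb 1 (p 5) (hp 5) h with h | h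
      · exact hin 5 le_rfl 1 (by omega) h.symm
      · exact hin 5 le_rfl 3 (by omega) h.symm
    have n35 : ¬ G.Adj (p 3) (p 5) := by
      intro h
      rcases nb 2 (p 5) (hp 5) h with h | h
      · exact hin 5 le_rfl 2 (by omega) h.symm
      · exact hin 5 le_rfl 4 (by omega) h.symm
    have n02 := hna 2 (by omega) 0 (by omega)
    have n03 := hna 3 (by omega) 0 (by omega)
    have n04 := hna 4 (by omega) 0 (by omega)
    have n13 := hna 3 (by omega) 1 (by omega)
    have n14 := hna 4 (by omega) 1 (by omega)
    have n24 := hna 4 (by omega) 2 (by omega)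
    have a01 := hadj 0
    have a12 := hadj 1
    have a23 := hadj 2
    have a34 := hadj 3
    have a45 := hadj 4
    have key : ∀ a b : Fin 6, a < b →
        (G.Adj (p a) (p b) ↔ (SimpleGraph.cycleGraph 6).Adj a b) := by
      intro a b hab
      have hdec : ∀ a b : Fin 6, a < b → ((SimpleGraph.cycleGraph 6).Adj a b ↔
        (a.val + 1 = b.val ∨ (a.val = 0 ∧ b.val = 5))) := by decide
      rw [hdec a b hab]
      fin_cases a <;> fin_cases b <;> first | (exfalso; revert hab; decide) | simp_all
    refine ⟨⟨fun i => p i, fun i j hij => ?_⟩, fun a b => ?_⟩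
    · rcases lt_trichotomy i j with h | h | h
      · exact absurd hij (hin j (by omega) i h)
      · exact h
      · exact absurd hij.symm (hin i (by omega) j h)
    · show G.Adj (p a) (p b) ↔ _
      rcases lt_trichotomy a b with h | h | h
      · exact key a b h
      · subst h; simp
      · rw [G.adj_comm, key b a h, SimpleGraph.adj_comm]
  · have hin := inj 7 (by omega)
    set X := (Finset.range 8).image p with hX
    have hXA : X ⊆ A := hsub 7
    have hXc : X.card = 8 := himg 7 (by omega)
    have hD0 : ({p 1, p 6} : Finset V) ⊆ A := by
      intro a ha
      simp only [Finset.mem_insert, Finset.mem_singleton] at ha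
      rcases ha with rfl | rfl <;> exact hp _
    have dm : ∀ i, i < 8 → i ≠ 3 → i ≠ 4 → Dm G {p 1, p 6} (p i) := by
      intro i hi h3 h4
      interval_cases i
      · exact Or.inr ⟨p 1, by simp, (hadj 0).symm⟩
      · exact Or.inl (by simp)
      · exact Or.inr ⟨p 1, by simp, hadj 1⟩
      · omega
      · omega
      · exact Or.inr ⟨p 6, by simp, (hadj 5).symm⟩
      · exact Or.inl (by simp)
      · exact Or.inr ⟨p 6, by simp, hadj 6⟩
    have und : ∀ z, ¬ Dm G {p 1, p 6} z → z ∈ X → z = p 3 ∨ z = p 4 := by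
      intro z hz hzX
      obtain ⟨i, hi, rfl⟩ := Finset.mem_image.1 hzX
      rw [Finset.mem_range] at hi
      by_contra hcon
      push Not at hcon
      exact hz (dm i hi (fun h => hcon.1 (h ▸ rfl)) (fun h => hcon.2 (h ▸ rfl)))
    -- undominated neighbours
    have un3 : ∀ z ∈ A, ¬ Dm G {p 1, p 6} z → G.Adj (p 3) z → z = p 4 := by
      intro z hz nz h
      rcases nb 2 z hz h with rfl | rfl
      · exact absurd (dm 2 (by omega) (by omega) (by omega)) nz
      · rfl
    have un4 : ∀ z ∈ A, ¬ Dm G {p 1, p 6} z → G.Adj (p 4) z → z = p 3 := by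
      intro z hz nz h
      rcases nb 3 z hz h with rfl | rfl
      · rfl
      · exact absurd (dm 5 (by omega) (by omega) (by omega)) nz
    obtain ⟨D, hD, hi, hc⟩ := glue (G := G) (D0 := {p 1, p 6}) hXA hD0 (by
      intro a ha b hb c hc hac hab hbc na nb' nc
      have hbX : b ≠ p 3 ∧ b ≠ p 4 := by
        constructor
        · rintro rfl
          exact hac ((un3 a ha na hab.symm).trans (un3 c hc nc hbc).symm)
        · rintro rfl
          exact hac ((un4 a ha na hab.symm).trans (un4 c hc nc hbc).symm)
      refine ⟨fun h => ?_, fun h => ?_, fun h => ?_⟩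
      · rcases und a na h with rfl | rfl
        · exact hbX.2 (un3 b hb nb' hab)
        · exact hbX.1 (un4 b hb nb' hab)
      · rcases und b nb' h with h | h
        · exact hbX.1 h
        · exact hbX.2 h
      · rcases und c nc h with rfl | rfl
        · exact hbX.2 (un3 b hb nb' hbc.symm)
        · exact hbX.1 (un4 b hb nb' hbc.symm))
      (comps_good IH hXA (Finset.card_pos.1 (by omega)))
    have hle : ((comps G (A \ X)).filter (fun C => Ext G C)).card ≤ 1 := by
      apply ext_le_one (x' := y)
      intro C hC hE
      obtain ⟨u, hu, hu7, w, hw, huw⟩ := link hA IH hno hXA hC hE (x := p 7)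
        (Finset.mem_image.2 ⟨7, by simp, rfl⟩)
      have hwC := (mem_comps.1 hC).1.1 hw
      rw [Finset.mem_sdiff] at hwC
      have hwX : ∀ i, i < 8 → w ≠ p i := by
        rintro i hi rfl
        exact hwC.2 (Finset.mem_image.2 ⟨i, by simpa using hi, rfl⟩)
      obtain ⟨i, hi, rfl⟩ := Finset.mem_image.1 hu
      rw [Finset.mem_range] at hi
      rcases Nat.eq_zero_or_pos i with rfl | hi0
      · rcases deg2 hdeg hv hx hy hwC.1 hvx hvy huw hxy with h | h
        · exact absurd h (hwX 1 (by omega))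
        · exact h ▸ hw
      · obtain ⟨l, rfl⟩ : ∃ l, i = l + 1 := ⟨i - 1, by omega⟩
        have hl7 : l + 1 ≠ 7 := fun h => hu7 (by rw [h])
        rcases nb l w hwC.1 huw with h | h
        · exact absurd h (hwX l (by omega))
        · exact absurd h (hwX (l + 2) (by omega))
    apply hno
    refine ⟨D, hD, hi, ?_⟩
    have := Finset.card_le_two (a := p 1) (b := p 6)
    omega

theorem main {G : SimpleGraph V} (h6 : ¬ HasInducedC6 G) :
    ∀ n, ∀ A : Finset V, A.card = n → Conn G A → Good G A := by
  intro n
  induction n using Nat.strong_induction_on with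
  | _ n ih =>
    rintro A rfl hA
    have IH : ∀ B, B.card < A.card → Conn G B → Good G B := fun B hB hc => ih B.card hB B rfl hc
    have h1 : ∃ D ⊆ A, Iso G A D ∧ 4 * D.card ≤ A.card + 1 := by
      by_cases h : ∃ v ∈ A, 3 ≤ (A.filter (fun x => G.Adj v x)).card
      · obtain ⟨v, hv, hd⟩ := h
        exact big_degree hA IH hv hd
      · push Not at h
        exact small_degree h6 hA IH (fun v hv => by have := h v hv; omega)
    exact ⟨h1, fun hE w hw => critical hA IH h1 hE w hw⟩

theorem conn_univ [Fintype V] {G : SimpleGraph V} (hc : G.Connected) : Conn G Finset.univ := by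
  have := hc.nonempty
  refine ⟨Finset.univ_nonempty, fun B hB hBn => ?_⟩
  obtain ⟨b, hb⟩ := hBn
  rw [Finset.eq_univ_iff_forall]
  intro z
  obtain ⟨w⟩ := hc.preconnected b z
  induction w with
  | nil => exact hb
  | cons h _ ih => exact ih (hB.2 _ hb _ (Finset.mem_univ _) h)

theorem iso_set {G : SimpleGraph V} {D : Set V} (h : ∀ a b c : V, a ≠ c → G.Adj a b →
    G.Adj b c → a ∈ closedNbhd G D ∨ b ∈ closedNbhd G D ∨ c ∈ closedNbhd G D) :
    IsP3IsolatingSet G D := by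
  rintro ⟨f, hf⟩
  have h01 : G.Adj (f 0).1 (f 1).1 := hf 0 1 (by simp [SimpleGraph.pathGraph_adj])
  have h12 : G.Adj (f 1).1 (f 2).1 := hf 1 2 (by simp [SimpleGraph.pathGraph_adj])
  have hne : (f 0).1 ≠ (f 2).1 := by
    intro h
    have := f.injective (Subtype.ext h)
    exact absurd this (by decide)
  rcases h _ _ _ hne h01 h12 with h | h | h
  · exact (f 0).2 h
  · exact (f 1).2 h
  · exact (f 2).2 h

end P3iso
end Helpers

theorem stmt_12 {V : Type*} [Fintype V] (G : SimpleGraph V)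
    (hc : G.Connected) (h6 : ¬ HasInducedC6 G)
    (hiota : 4 * iotaP3 G = Fintype.card V + 1) :
    ∀ v : V, iotaP3 (SimpleGraph.induce ({v}ᶜ : Set V) G) ≤ iotaP3 G - 1 := by
  classical
  intro v
  have hgood := P3iso.main h6 _ Finset.univ rfl (P3iso.conn_univ hc)
  have hE : P3iso.Ext G Finset.univ := by
    intro D _ hD
    have hle : iotaP3 G ≤ D.card := by
      apply Nat.sInf_le
      refine ⟨(D : Set V), P3iso.iso_set ?_, Set.ncard_coe_finset D⟩
      intro a b c hac hab hbc
      exact hD a (Finset.mem_univ _) b (Finset.mem_univ _) c (Finset.mem_univ _) hac hab hbc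
    rw [Finset.card_univ]
    omega
  obtain ⟨D, hD, hi, hcard⟩ := hgood.2 hE v (Finset.mem_univ v)
  rw [Finset.card_univ] at hcard
  have hDv : ∀ d ∈ D, d ∈ ({v}ᶜ : Set V) := by
    intro d hd
    have := hD hd
    simpa using this
  have hle : iotaP3 (SimpleGraph.induce ({v}ᶜ : Set V) G) ≤ D.card := by
    apply Nat.sInf_le
    refine ⟨{x | x.1 ∈ D}, P3iso.iso_set ?_, ?_⟩
    · intro a b c hac hab hbc
      have aux : ∀ z : ({v}ᶜ : Set V), P3iso.Dm G D z.1 →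
          z ∈ closedNbhd (SimpleGraph.induce ({v}ᶜ : Set V) G) {x | x.1 ∈ D} := by
        rintro z (hz | ⟨d, hd, hdz⟩)
        · exact Or.inl hz
        · exact Or.inr ⟨⟨d, hDv d hd⟩, hd, hdz⟩
      have mem : ∀ z : ({v}ᶜ : Set V), z.1 ∈ Finset.univ \ {v} := by
        intro z
        have hz : z.1 ≠ v := z.2
        simpa using hz
      have := hi a.1 (by convert mem a) b.1 (by convert mem b) c.1 (by convert mem c)
        (fun h => hac (Subtype.ext h)) hab hbc
      rcases this with h | h | h
      · exact Or.inl (aux a h)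
      · exact Or.inr (Or.inl (aux b h))
      · exact Or.inr (Or.inr (aux c h))
    · have himg : (Subtype.val '' {x : ({v}ᶜ : Set V) | x.1 ∈ D}) = (D : Set V) := by
        ext z
        constructor
        · rintro ⟨w, hw, rfl⟩
          exact hw
        · intro hz
          exact ⟨⟨z, hDv z hz⟩, hz, rfl⟩
      rw [← Set.ncard_image_of_injective _ Subtype.val_injective, himg, Set.ncard_coe_finset]
  omega
end
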